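/- arXiv:math/0409001 — 2 statements merged into one kernel-verified Lean document; each statement's English description precedes it below -/
import Mathlib

section
/- Let (w_t)_{t≥1} be a sequence of positive reals with C_1(w) < ∞. Let (X,μ) be a probability space and for each t ≥ 1 let 𝒯_t be a finite family of at most 2^t measure-preserving transformations of (X,μ); set A_t f(x) = 2^{-t}·Σ_{T∈𝒯_t} f(T x). Then for every f ∈ L^1(μ), ‖sup_t w_t·A_t f‖_{1,∞} ≤ 9·C_1(w)·‖f‖_1. -/
open MeasureTheory Filter ENNReal

/-- `C₁(w) = sup_{y>0} Σ_{t≥1} w_t·[y < w_t < 2^t·y]`. -/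
noncomputable def C1 (w : ℕ → ℝ) : ℝ≥0∞ :=
  ⨆ (y : ℝ) (_ : 0 < y), ∑' t : ℕ,
    if 1 ≤ t ∧ y < w t ∧ w t < 2 ^ t * y then ENNReal.ofReal (w t) else 0

/-- The weak `L^p` (quasi-)norm `‖g‖_{p,∞} = sup_{y>0} y · μ{x : g x ≥ y}^{1/p}` of an
extended-nonnegative-valued function `g`. -/
noncomputable def wnormE {X : Type*} [MeasurableSpace X] (μ : Measure X) (p : ℝ)
    (g : X → ℝ≥0∞) : ℝ≥0∞ :=
  ⨆ (y : ℝ) (_ : 0 < y), ENNReal.ofReal y * (μ {x | ENNReal.ofReal y ≤ g x}) ^ (1 / p)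

lemma ofReal_le_C1 {w : ℕ → ℝ} {t : ℕ} (ht : 1 ≤ t) (hw : 0 < w t) :
    ENNReal.ofReal (w t) ≤ C1 w := by
  have h2 : (2 : ℝ) ≤ 2 ^ t := by
    simpa using pow_le_pow_right₀ (one_le_two : (1 : ℝ) ≤ 2) ht
  have hcond : 1 ≤ t ∧ 3 / 4 * w t < w t ∧ w t < 2 ^ t * (3 / 4 * w t) :=
    ⟨ht, by linarith, by nlinarith⟩
  unfold C1
  refine le_iSup₂_of_le (3 / 4 * w t) (by positivity) ?_
  refine le_trans ?_ (ENNReal.le_tsum t)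
  rw [if_pos hcond]

lemma sum_range_two_pow_of_le {R : ℝ} (hR : 0 ≤ R) (n : ℕ) :
    ∑ t ∈ Finset.range n, (if (2 : ℝ) ^ t ≤ R then (2 : ℝ) ^ t else 0) ≤ 2 * R := by
  induction n with
  | zero => simpa using hR
  | succ n ih =>
    by_cases h : (2 : ℝ) ^ n ≤ R
    · calc ∑ t ∈ Finset.range (n + 1), (if (2 : ℝ) ^ t ≤ R then (2 : ℝ) ^ t else 0)
          ≤ ∑ t ∈ Finset.range (n + 1), (2 : ℝ) ^ t := by
            refine Finset.sum_le_sum fun t _ => ?_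
            split_ifs
            · exact le_rfl
            · positivity
        _ = 2 ^ (n + 1) - 1 := by
            rw [geom_sum_eq (by norm_num)]; norm_num
        _ ≤ 2 * R := by rw [pow_succ]; linarith
    · rw [Finset.sum_range_succ, if_neg h, add_zero]
      exact ih

/-- The part of `w t * v` in the middle range `(l / 2, 2 ^ t * l / 2)`. -/
noncomputable def midPart (w : ℕ → ℝ) (l : ℝ) (t : ℕ) (v : ℝ) : ℝ :=
  if 1 ≤ t ∧ l < 2 * (w t * v) ∧ 2 * (w t * v) < 2 ^ t * l then w t * v else 0

/-- A penalty `2 ^ t * l / 4` charged when `w t * v` is at least `2 ^ t * l / 2`. -/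
noncomputable def largePart (w : ℕ → ℝ) (l : ℝ) (t : ℕ) (v : ℝ) : ℝ :=
  if 1 ≤ t ∧ 2 ^ t * l ≤ 2 * (w t * v) then l / 4 * 2 ^ t else 0

lemma midPart_nonneg {w : ℕ → ℝ} (hw : ∀ t : ℕ, 1 ≤ t → 0 < w t) (l : ℝ) (t : ℕ) {v : ℝ}
    (hv : 0 ≤ v) : 0 ≤ midPart w l t v := by
  unfold midPart
  split_ifs with h
  · exact mul_nonneg (hw t h.1).le hv
  · exact le_rfl

lemma largePart_nonneg (w : ℕ → ℝ) {l : ℝ} (hl : 0 < l) (t : ℕ) (v : ℝ) :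
    0 ≤ largePart w l t v := by
  unfold largePart
  split_ifs <;> positivity

lemma tsum_midPart_le (w : ℕ → ℝ) {l v : ℝ} (hl : 0 < l) (hv : 0 ≤ v) :
    ∑' t, ENNReal.ofReal (midPart w l t v) ≤ C1 w * ENNReal.ofReal v := by
  rcases hv.eq_or_lt with rfl | hv
  · simp [midPart]
  have hle : (∑' t : ℕ, if 1 ≤ t ∧ l / (2 * v) < w t ∧ w t < 2 ^ t * (l / (2 * v))
      then ENNReal.ofReal (w t) else 0) ≤ C1 w :=
    le_iSup₂_of_le (f := fun (y : ℝ) (_ : 0 < y) => ∑' t : ℕ,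
      if 1 ≤ t ∧ y < w t ∧ w t < 2 ^ t * y then ENNReal.ofReal (w t) else 0)
      (l / (2 * v)) (by positivity) le_rfl
  refine le_trans ?_ (mul_le_mul_left hle _)
  rw [← ENNReal.tsum_mul_right]
  refine ENNReal.tsum_le_tsum fun t => ?_
  unfold midPart
  split_ifs with h1 h2 h2
  · rw [ENNReal.ofReal_mul' hv.le]
  · refine absurd ⟨h1.1, ?_, ?_⟩ h2
    · rw [div_lt_iff₀ (by positivity)]; linarith [h1.2.1]
    · rw [← mul_div_assoc, lt_div_iff₀ (by positivity)]; linarith [h1.2.2]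
  · simp
  · simp

lemma tsum_largePart_le {w : ℕ → ℝ} (hw : ∀ t : ℕ, 1 ≤ t → 0 < w t) (hC1 : C1 w ≠ ⊤)
    {l v : ℝ} (hl : 0 < l) (hv : 0 ≤ v) :
    ∑' t, ENNReal.ofReal (largePart w l t v) ≤ C1 w * ENNReal.ofReal v := by
  obtain ⟨c, hc⟩ : ∃ c, c = (C1 w).toReal := ⟨_, rfl⟩
  have hc0 : 0 ≤ c := hc ▸ ENNReal.toReal_nonneg
  have hC : C1 w = ENNReal.ofReal c := by rw [hc, ENNReal.ofReal_toReal hC1]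
  have hwc : ∀ t, 1 ≤ t → w t ≤ c := fun t ht =>
    (ENNReal.ofReal_le_ofReal_iff hc0).1 (hC ▸ ofReal_le_C1 ht (hw t ht))
  rw [hC, ← ENNReal.ofReal_mul hc0]
  refine ENNReal.tsum_le_of_sum_range_le fun n => ?_
  rw [← ENNReal.ofReal_sum_of_nonneg fun t _ => largePart_nonneg w hl t v]
  refine ENNReal.ofReal_le_ofReal ?_
  have hR : 0 ≤ 2 * (c * v) / l := by positivity
  calc ∑ t ∈ Finset.range n, largePart w l t v
      ≤ ∑ t ∈ Finset.range n,
          l / 4 * (if (2 : ℝ) ^ t ≤ 2 * (c * v) / l then (2 : ℝ) ^ t else 0) := by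
        refine Finset.sum_le_sum fun t _ => ?_
        unfold largePart
        split_ifs with h1 h2 h2
        · exact le_rfl
        · refine absurd ?_ h2
          rw [le_div_iff₀ hl]
          have := mul_le_mul_of_nonneg_right (hwc t h1.1) hv
          linarith [h1.2]
        · positivity
        · simp
    _ ≤ l / 4 * (2 * (2 * (c * v) / l)) := by
        rw [← Finset.mul_sum]
        exact mul_le_mul_of_nonneg_left (sum_range_two_pow_of_le hR n) (by positivity)
    _ = c * v := by field_simp; norm_num

lemma le_sum_midPart_add_largePart {ι : Type*} (s : Finset ι) {w : ℕ → ℝ} {l : ℝ} {t : ℕ}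
    (hw : ∀ t : ℕ, 1 ≤ t → 0 < w t) (ht : 1 ≤ t) (hl : 0 < l) (hs : s.card ≤ 2 ^ t) (a : ι → ℝ)
    (ha : ∀ i ∈ s, 0 ≤ a i) (h : 3 / 4 * l * 2 ^ t ≤ w t * ∑ i ∈ s, a i) :
    l / 4 * 2 ^ t ≤ ∑ i ∈ s, (midPart w l t (a i) + largePart w l t (a i)) := by
  have hm : ∀ i ∈ s, 0 ≤ midPart w l t (a i) := fun i hi =>
    midPart_nonneg hw l t (ha i hi)
  have hL : ∀ i, 0 ≤ largePart w l t (a i) := fun i => largePart_nonneg w hl t (a i)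
  by_cases hbig : ∃ i ∈ s, 2 ^ t * l ≤ 2 * (w t * a i)
  · obtain ⟨i, hi, hbi⟩ := hbig
    refine le_trans ?_ (Finset.single_le_sum (fun j hj => add_nonneg (hm j hj) (hL j)) hi)
    have : largePart w l t (a i) = l / 4 * 2 ^ t := if_pos ⟨ht, hbi⟩
    linarith [hm i hi]
  · push Not at hbig
    have hcard : (s.card : ℝ) ≤ 2 ^ t := by exact_mod_cast hs
    calc l / 4 * 2 ^ t ≤ w t * ∑ i ∈ s, a i - s.card * (l / 2) := by nlinarith
      _ = ∑ i ∈ s, (w t * a i - l / 2) := by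
          rw [Finset.sum_sub_distrib, Finset.mul_sum, Finset.sum_const, nsmul_eq_mul]
      _ ≤ _ := by
          refine Finset.sum_le_sum fun i hi => ?_
          have h1 := hL i
          have h2 := hm i hi
          by_cases hlt : l < 2 * (w t * a i)
          · have : midPart w l t (a i) = w t * a i := if_pos ⟨ht, hlt, hbig i hi⟩
            linarith
          · linarith

lemma measurable_midPart (w : ℕ → ℝ) (l : ℝ) (t : ℕ) : Measurable (midPart w l t) := by
  unfold midPart
  refine Measurable.ite ?_ (by fun_prop) measurable_const
  exact (MeasurableSet.const _).inter
    ((measurableSet_lt measurable_const ((measurable_id.const_mul _).const_mul _)).inter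
      (measurableSet_lt ((measurable_id.const_mul _).const_mul _) measurable_const))

lemma measurable_largePart (w : ℕ → ℝ) (l : ℝ) (t : ℕ) : Measurable (largePart w l t) := by
  unfold largePart
  refine Measurable.ite ?_ measurable_const measurable_const
  exact (MeasurableSet.const _).inter 
    (measurableSet_le measurable_const ((measurable_id.const_mul _).const_mul _))

/-- Averages over at most `2 ^ t` measure-preserving maps, summed over `t`, have integral at most
that of the sum of the averaged functions. -/
lemma lintegral_tsum_average_le {X : Type*} [MeasurableSpace X] {μ : Measure X}
    {𝒯 : ℕ → Finset (X → X)} (hcard : ∀ t : ℕ, 1 ≤ t → (𝒯 t).card ≤ 2 ^ t)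
    (hmp : ∀ t : ℕ, 1 ≤ t → ∀ T ∈ 𝒯 t, MeasurePreserving T μ μ)
    {k : ℕ → X → ℝ≥0∞} (hk : ∀ t, Measurable (k t)) :
    ∫⁻ x, ∑' t : ℕ, (if 1 ≤ t then (2 ^ t : ℝ≥0∞)⁻¹ * ∑ T ∈ 𝒯 t, k t (T x) else 0) ∂μ
      ≤ ∫⁻ x, ∑' t, k t x ∂μ := by
  have hmeas : ∀ t, 1 ≤ t → ∀ T ∈ 𝒯 t, Measurable fun x => k t (T x) := fun t ht T hT =>
    (hk t).comp (hmp t ht T hT).measurable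
  rw [lintegral_tsum fun t => (hk t).aemeasurable, lintegral_tsum]
  · refine ENNReal.tsum_le_tsum fun t => ?_
    split_ifs with ht
    · rw [lintegral_const_mul _ (Finset.measurable_fun_sum _ (hmeas t ht)),
        lintegral_finsetSum _ (hmeas t ht),
        Finset.sum_congr rfl fun T hT => (hmp t ht T hT).lintegral_comp (hk t),
        Finset.sum_const, nsmul_eq_mul, ← mul_assoc]
      have hc : ((𝒯 t).card : ℝ≥0∞) ≤ 2 ^ t := by exact_mod_cast hcard t ht
      calc _ ≤ (2 ^ t : ℝ≥0∞)⁻¹ * 2 ^ t * ∫⁻ x, k t x ∂μ := by gcongr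
        _ = ∫⁻ x, k t x ∂μ := by
          rw [ENNReal.inv_mul_cancel (by simp) (by simp), one_mul]
    · simp
  · intro t
    split_ifs with ht
    · exact ((Finset.measurable_fun_sum _ (hmeas t ht)).const_mul _).aemeasurable
    · exact aemeasurable_const

lemma exists_lt_mul_sum_of_le_iSup {X : Type*} {w : ℕ → ℝ} {𝒯 : ℕ → Finset (X → X)}
    {f : X → ℝ} {x : X} {l : ℝ} (hl : 0 < l)
    (h : ENNReal.ofReal l ≤ ⨆ (t : ℕ) (_ : 1 ≤ t),
      ENNReal.ofReal (w t * ((2 ^ t : ℝ)⁻¹ * ∑ T ∈ 𝒯 t, f (T x)))) :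
    ∃ t, 1 ≤ t ∧ 3 / 4 * l * 2 ^ t < w t * ∑ T ∈ 𝒯 t, f (T x) := by
  have h1 : ENNReal.ofReal (3 / 4 * l) < ENNReal.ofReal l :=
    (ENNReal.ofReal_lt_ofReal_iff hl).2 (by linarith)
  obtain ⟨t, ht⟩ := lt_iSup_iff.1 (h1.trans_le h)
  obtain ⟨ht1, ht⟩ := lt_iSup_iff.1 ht
  refine ⟨t, ht1, ?_⟩
  have h2 := (ENNReal.ofReal_lt_ofReal_iff_of_nonneg (by positivity)).1 ht
  rwa [← lt_div_iff₀ (by positivity), mul_div_assoc, div_eq_inv_mul (Finset.sum _ _)]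

lemma mul_measure_le_iSup_average {X : Type*} [MeasurableSpace X] (μ : Measure X)
    {w : ℕ → ℝ} (hw : ∀ t : ℕ, 1 ≤ t → 0 < w t) (hC1 : C1 w ≠ ⊤)
    {𝒯 : ℕ → Finset (X → X)}
    (hcard : ∀ t : ℕ, 1 ≤ t → (𝒯 t).card ≤ 2 ^ t)
    (hmp : ∀ t : ℕ, 1 ≤ t → ∀ T ∈ 𝒯 t, MeasurePreserving T μ μ)
    {f : X → ℝ} (hf : Measurable f) {l : ℝ} (hl : 0 < l) :
    ENNReal.ofReal l * μ {x | ENNReal.ofReal l ≤ ⨆ (t : ℕ) (_ : 1 ≤ t),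
        ENNReal.ofReal (w t * ((2 ^ t : ℝ)⁻¹ * ∑ T ∈ 𝒯 t, f (T x)))}
      ≤ 8 * C1 w * ∫⁻ x, ‖f x‖ₑ ∂μ := by
  set k : ℕ → X → ℝ≥0∞ := fun t x =>
    ENNReal.ofReal (midPart w l t |f x|) + ENNReal.ofReal (largePart w l t |f x|) with hkdef
  have habs : Measurable fun x => |f x| := hf.abs
  have hk : ∀ t, Measurable (k t) := fun t =>
    ((measurable_midPart w l t).comp habs).ennreal_ofReal.add
      ((measurable_largePart w l t).comp habs).ennreal_ofReal
  set H : X → ℝ≥0∞ := fun x =>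
    ∑' t : ℕ, (if 1 ≤ t then (2 ^ t : ℝ≥0∞)⁻¹ * ∑ T ∈ 𝒯 t, k t (T x) else 0) with hH
  have hHint : ∫⁻ x, H x ∂μ ≤ 2 * C1 w * ∫⁻ x, ‖f x‖ₑ ∂μ := by
    refine (lintegral_tsum_average_le hcard hmp hk).trans ?_
    rw [← lintegral_const_mul _ hf.enorm]
    refine lintegral_mono fun x => ?_
    simp only [hkdef]
    rw [ENNReal.tsum_add, Real.enorm_eq_ofReal_abs, two_mul, add_mul]
    exact add_le_add (tsum_midPart_le w hl (abs_nonneg _))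
      (tsum_largePart_le hw hC1 hl (abs_nonneg _))
  have hsub : {x | ENNReal.ofReal l ≤ ⨆ (t : ℕ) (_ : 1 ≤ t),
      ENNReal.ofReal (w t * ((2 ^ t : ℝ)⁻¹ * ∑ T ∈ 𝒯 t, f (T x)))}
      ⊆ {x | ENNReal.ofReal (l / 4) ≤ H x} := by
    intro x hx
    obtain ⟨t, ht, hlt⟩ := exists_lt_mul_sum_of_le_iSup hl hx
    have hsum : 3 / 4 * l * 2 ^ t ≤ w t * ∑ T ∈ 𝒯 t, |f (T x)| :=
      hlt.le.trans (mul_le_mul_of_nonneg_left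
        (Finset.sum_le_sum fun T _ => le_abs_self _) (hw t ht).le)
    have hkey := le_sum_midPart_add_largePart (𝒯 t) hw ht hl (hcard t ht)
      (fun T => |f (T x)|) (fun T _ => abs_nonneg _) hsum
    have hkey' : ENNReal.ofReal (l / 4) * 2 ^ t ≤ ∑ T ∈ 𝒯 t, k t (T x) := by
      calc ENNReal.ofReal (l / 4) * 2 ^ t = ENNReal.ofReal (l / 4 * 2 ^ t) := by
            rw [ENNReal.ofReal_mul (by positivity), ENNReal.ofReal_pow (by norm_num)]
            simp
        _ ≤ _ := ENNReal.ofReal_le_ofReal hkey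
        _ = ∑ T ∈ 𝒯 t, ENNReal.ofReal (midPart w l t |f (T x)| + largePart w l t |f (T x)|) :=
            ENNReal.ofReal_sum_of_nonneg fun T _ => add_nonneg
              (midPart_nonneg hw l t (abs_nonneg _)) (largePart_nonneg w hl t _)
        _ ≤ _ := Finset.sum_le_sum fun T _ => ENNReal.ofReal_add_le
    refine le_trans ?_ (ENNReal.le_tsum t)
    rw [if_pos ht]
    calc ENNReal.ofReal (l / 4) = (2 ^ t : ℝ≥0∞)⁻¹ * (ENNReal.ofReal (l / 4) * 2 ^ t) := by
          rw [mul_comm (ENNReal.ofReal _), ← mul_assoc,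
            ENNReal.inv_mul_cancel (by simp) (by simp), one_mul]
      _ ≤ _ := by gcongr
  have hHmeas : Measurable H := by
    refine Measurable.tsum fun t => ?_
    split_ifs with ht
    · exact (Finset.measurable_fun_sum _ fun T hT =>
        (hk t).comp (hmp t ht T hT).measurable).const_mul _
    · exact measurable_const
  have hl4 : ENNReal.ofReal l = 4 * ENNReal.ofReal (l / 4) := by
    rw [show (4 : ℝ≥0∞) = ENNReal.ofReal 4 by simp, ← ENNReal.ofReal_mul (by norm_num)]
    congr 1; ring
  calc _ ≤ ENNReal.ofReal l * μ {x | ENNReal.ofReal (l / 4) ≤ H x} := by gcongr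
    _ = 4 * (ENNReal.ofReal (l / 4) * μ {x | ENNReal.ofReal (l / 4) ≤ H x}) := by
        rw [hl4, mul_assoc]
    _ ≤ 4 * (2 * C1 w * ∫⁻ x, ‖f x‖ₑ ∂μ) :=
        mul_le_mul_right ((mul_meas_ge_le_lintegral hHmeas _).trans hHint) _
    _ = _ := by ring

theorem stmt3 {X : Type*} [MeasurableSpace X] (μ : Measure X) [IsProbabilityMeasure μ]
    (w : ℕ → ℝ) (hw : ∀ t : ℕ, 1 ≤ t → 0 < w t) (hC1 : C1 w ≠ ⊤)
    (𝒯 : ℕ → Finset (X → X))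
    (hcard : ∀ t : ℕ, 1 ≤ t → (𝒯 t).card ≤ 2 ^ t)
    (hmp : ∀ t : ℕ, 1 ≤ t → ∀ T ∈ 𝒯 t, MeasurePreserving T μ μ)
    (f : X → ℝ) (hf : Integrable f μ) :
    wnormE μ 1 (fun x => ⨆ (t : ℕ) (_ : 1 ≤ t),
        ENNReal.ofReal (w t * ((2 ^ t : ℝ)⁻¹ * ∑ T ∈ 𝒯 t, f (T x))))
      ≤ 9 * C1 w * eLpNorm f 1 μ := by
  unfold wnormE
  refine iSup₂_le fun l hl => ?_
  rw [div_one, ENNReal.rpow_one]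
  obtain ⟨g, hg, hfg⟩ : ∃ g : X → ℝ, Measurable g ∧ f =ᵐ[μ] g :=
    ⟨_, hf.1.stronglyMeasurable_mk.measurable, hf.1.ae_eq_mk⟩
  have hae : ∀ᵐ x ∂μ, ∀ t : ℕ, 1 ≤ t → ∀ T ∈ 𝒯 t, f (T x) = g (T x) := by
    rw [ae_all_iff]
    intro t
    by_cases ht : 1 ≤ t
    · filter_upwards [(Filter.eventually_all_finset (𝒯 t)).2 fun T hT =>
        (hmp t ht T hT).quasiMeasurePreserving.ae hfg] with x hx _
      exact hx
    · exact Eventually.of_forall fun x h => absurd h ht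
  have hnorm : eLpNorm f 1 μ = ∫⁻ x, ‖g x‖ₑ ∂μ := by
    rw [eLpNorm_congr_ae hfg, eLpNorm_one_eq_lintegral_enorm]
  have hmono : μ {x | ENNReal.ofReal l ≤ ⨆ (t : ℕ) (_ : 1 ≤ t),
      ENNReal.ofReal (w t * ((2 ^ t : ℝ)⁻¹ * ∑ T ∈ 𝒯 t, f (T x)))}
      ≤ μ {x | ENNReal.ofReal l ≤ ⨆ (t : ℕ) (_ : 1 ≤ t),
      ENNReal.ofReal (w t * ((2 ^ t : ℝ)⁻¹ * ∑ T ∈ 𝒯 t, g (T x)))} := by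
    refine measure_mono_ae ?_
    filter_upwards [hae] with x hx h
    refine le_trans h (iSup₂_mono fun t ht => ?_)
    rw [Finset.sum_congr rfl (hx t ht)]
  rw [hnorm]
  refine (mul_le_mul_right hmono _).trans
    ((mul_measure_le_iSup_average μ hw hC1 hcard hmp hg hl).trans ?_)
  gcongr
  norm_num
end

section
/- Let (w_t)_{t≥1} be a sequence of positive reals. (1) If there exists K > 0 such that w_t ≤ K/Φ(t) for all t (large enough for Φ to be defined), then C_1(w) < ∞. (2) If w_t·Φ(t) → ∞ as t → ∞, then C_1(w) = ∞. -/
open MeasureTheory Filter ENNReal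

/-- Iterated natural logarithm: `logIter j t = log^{(j)}(t)`. -/
noncomputable def logIter : ℕ → ℝ → ℝ
  | 0, t => t
  | (j + 1), t => Real.log (logIter j t)

noncomputable def iterCount (t : ℝ) : ℕ := by
  classical exact if h : ∃ j, logIter j t ≤ 1 then Nat.find h else 0

/-- `Φ(t) = t · log t · log log t ⋯`, the product of `t` and all iterated logarithms
of `t` that are defined and exceed `1`. -/
noncomputable def Phi (t : ℝ) : ℝ :=
  ∏ j ∈ Finset.range (iterCount t), logIter j t

lemma logIter_succ' (j : ℕ) (t : ℝ) : logIter (j + 1) t = logIter j (Real.log t) := by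
  induction j with
  | zero => rfl
  | succ j ih =>
    change Real.log (logIter (j + 1) t) = Real.log (logIter j (Real.log t))
    rw [ih]

lemma exists_logIter_le_one (t : ℝ) : ∃ j, logIter j t ≤ 1 := by
  by_contra! h
  have key : ∀ j : ℕ, logIter j t ≤ t - j := by
    intro j
    induction j with
    | zero => simp [logIter]
    | succ j ih =>
      have h1 := Real.log_le_sub_one_of_pos (zero_lt_one.trans (h j))
      change Real.log (logIter j t) ≤ _
      push_cast
      linarith
  obtain ⟨n, hn⟩ := exists_nat_gt t
  linarith [key n, h n]

lemma iterCount_of_le_one {t : ℝ} (ht : t ≤ 1) : iterCount t = 0 := by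
  classical
  unfold iterCount
  rw [dif_pos (exists_logIter_le_one t), Nat.find_eq_zero]
  exact ht

lemma iterCount_of_one_lt {t : ℝ} (ht : 1 < t) :
    iterCount t = iterCount (Real.log t) + 1 := by
  classical
  unfold iterCount
  rw [dif_pos (exists_logIter_le_one t), dif_pos (exists_logIter_le_one (Real.log t))]
  have h2 : ∃ j, logIter (j + 1) t ≤ 1 := by
    simpa only [logIter_succ'] using exists_logIter_le_one (Real.log t)
  rw [Nat.find_comp_succ (exists_logIter_le_one t) h2 (not_le.2 ht)]
  simp only [logIter_succ']

lemma iterLog_induction {P : ℝ → Prop} (base : ∀ t, t ≤ 1 → P t)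
    (step : ∀ t, 1 < t → P (Real.log t) → P t) (t : ℝ) : P t := by
  induction hn : iterCount t generalizing t with
  | zero =>
    refine base t (not_lt.1 fun h => ?_)
    rw [iterCount_of_one_lt h] at hn
    omega
  | succ n ih =>
    by_cases h : t ≤ 1
    · exact base t h
    · rw [not_le] at h
      rw [iterCount_of_one_lt h] at hn
      exact step t h (ih _ (by omega))

lemma Phi_of_le_one {t : ℝ} (ht : t ≤ 1) : Phi t = 1 := by
  simp [Phi, iterCount_of_le_one ht]

lemma Phi_of_one_le {t : ℝ} (ht : 1 ≤ t) : Phi t = t * Phi (Real.log t) := by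
  rcases ht.eq_or_lt with rfl | ht
  · rw [Phi_of_le_one le_rfl, Phi_of_le_one (by simp)]
    norm_num
  · unfold Phi
    rw [iterCount_of_one_lt ht, Finset.prod_range_succ', mul_comm]
    simp only [logIter_succ']
    rfl

lemma one_le_Phi (t : ℝ) : 1 ≤ Phi t := by
  induction t using iterLog_induction with
  | base t ht => rw [Phi_of_le_one ht]
  | step t ht ih =>
    rw [Phi_of_one_le ht.le]
    nlinarith

lemma Phi_pos (t : ℝ) : 0 < Phi t := zero_lt_one.trans_le (one_le_Phi t)

lemma le_Phi (t : ℝ) : t ≤ Phi t := by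
  rcases le_total t 1 with h | h
  · exact h.trans (one_le_Phi t)
  · rw [Phi_of_one_le h]
    exact le_mul_of_one_le_right (by linarith) (one_le_Phi _)

lemma sq_le_exp {s : ℝ} (hs : 0 ≤ s) : s ^ 2 ≤ Real.exp s := by
  have h1 := Real.add_one_le_exp (s / 2 - 1)
  have h2 := Real.add_one_le_exp (1 : ℝ)
  have h3 : Real.exp (s / 2) = Real.exp (s / 2 - 1) * Real.exp 1 := by
    rw [← Real.exp_add]
    ring_nf
  have h4 : s ≤ Real.exp (s / 2) := by
    rw [h3]
    nlinarith [Real.exp_pos (s / 2 - 1)]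
  calc s ^ 2 ≤ Real.exp (s / 2) ^ 2 := by gcongr
    _ = Real.exp s := by
      rw [← Real.exp_nat_mul]
      ring_nf

lemma Phi_le_exp {s : ℝ} (hs : 0 ≤ s) : Phi s ≤ Real.exp s := by
  induction s using iterLog_induction with
  | base t ht =>
    rw [Phi_of_le_one ht]
    exact Real.one_le_exp hs
  | step t ht ih =>
    rw [Phi_of_one_le ht.le]
    have h := ih (Real.log_nonneg ht.le)
    rw [Real.exp_log (by linarith)] at h
    calc t * Phi (Real.log t) ≤ t * t := by gcongr
      _ = t ^ 2 := by ring
      _ ≤ _ := sq_le_exp hs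

lemma Phi_le_sq {t : ℝ} (ht : 1 ≤ t) : Phi t ≤ t ^ 2 := by
  have h := Phi_le_exp (Real.log_nonneg ht)
  rw [Real.exp_log (by linarith)] at h
  rw [Phi_of_one_le ht, sq]
  gcongr

/-- The antiderivative of `1 / Φ` vanishing at `1`. -/
noncomputable def iterLogSum (t : ℝ) : ℝ := iterCount t + logIter (iterCount t) t - 1

lemma iterLogSum_of_le_one {t : ℝ} (ht : t ≤ 1) : iterLogSum t = t - 1 := by
  simp [iterLogSum, iterCount_of_le_one ht, logIter]

lemma iterLogSum_of_one_le {t : ℝ} (ht : 1 ≤ t) :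
    iterLogSum t = 1 + iterLogSum (Real.log t) := by
  rcases ht.eq_or_lt with rfl | ht
  · rw [iterLogSum_of_le_one le_rfl, iterLogSum_of_le_one (by simp)]
    norm_num
  · unfold iterLogSum
    rw [iterCount_of_one_lt ht, logIter_succ']
    push_cast
    ring

lemma div_Phi_right_le {a b : ℝ} (hab : a ≤ b) :
    (b - a) / Phi b ≤ iterLogSum b - iterLogSum a := by
  induction b using iterLog_induction generalizing a with
  | base b hb =>
    rw [Phi_of_le_one hb, iterLogSum_of_le_one hb, iterLogSum_of_le_one (hab.trans hb)]
    linarith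
  | step b hb ih =>
    have main : ∀ a : ℝ, 1 ≤ a → a ≤ b →
        (b - a) / Phi b ≤ iterLogSum b - iterLogSum a := by
      intro a ha hab
      have ha0 : 0 < a := by linarith
      have hb0 : 0 < b := by linarith
      have h1 := ih (Real.log_le_log ha0 hab)
      have h2 : (b - a) / b ≤ Real.log b - Real.log a := by
        have h := Real.one_sub_inv_le_log_of_pos (div_pos hb0 ha0)
        rw [Real.log_div hb0.ne' ha0.ne', inv_div] at h
        rwa [sub_div, div_self hb0.ne']
      rw [Phi_of_one_le hb.le, iterLogSum_of_one_le hb.le, iterLogSum_of_one_le ha, ← div_div]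
      have h3 := div_le_div_of_nonneg_right h2 (Phi_pos (Real.log b)).le
      linarith
    rcases le_total 1 a with ha | ha
    · exact main a ha hab
    · have h1 := main 1 le_rfl hb.le
      have h2 : (1 - a) / Phi b ≤ 1 - a := div_le_self (by linarith) (one_le_Phi b)
      rw [iterLogSum_of_le_one le_rfl] at h1
      rw [iterLogSum_of_le_one ha]
      have h3 : (b - a) / Phi b = (b - 1) / Phi b + (1 - a) / Phi b := by ring
      linarith

lemma le_div_Phi_left {a b : ℝ} (hab : a ≤ b) :
    iterLogSum b - iterLogSum a ≤ (b - a) / Phi a := by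
  induction b using iterLog_induction generalizing a with
  | base b hb =>
    rw [Phi_of_le_one (hab.trans hb), iterLogSum_of_le_one hb,
      iterLogSum_of_le_one (hab.trans hb)]
    linarith
  | step b hb ih =>
    have main : ∀ a : ℝ, 1 ≤ a → a ≤ b →
        iterLogSum b - iterLogSum a ≤ (b - a) / Phi a := by
      intro a ha hab
      have ha0 : 0 < a := by linarith
      have hb0 : 0 < b := by linarith
      have h1 := ih (Real.log_le_log ha0 hab)
      have h2 : Real.log b - Real.log a ≤ (b - a) / a := by
        have h := Real.log_le_sub_one_of_pos (div_pos hb0 ha0)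
        rw [Real.log_div hb0.ne' ha0.ne'] at h
        rwa [sub_div, div_self ha0.ne']
      rw [Phi_of_one_le ha, iterLogSum_of_one_le hb.le, iterLogSum_of_one_le ha, ← div_div]
      have h3 := div_le_div_of_nonneg_right h2 (Phi_pos (Real.log a)).le
      linarith
    rcases le_total 1 a with ha | ha
    · exact main a ha hab
    · have h1 := main 1 le_rfl hb.le
      rw [iterLogSum_of_le_one le_rfl, Phi_of_le_one le_rfl] at h1
      rw [iterLogSum_of_le_one ha, Phi_of_le_one ha]
      linarith

lemma iterLogSum_mono : Monotone iterLogSum := fun a b hab => by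
  have h : 0 ≤ (b - a) / Phi b := div_nonneg (sub_nonneg.2 hab) (Phi_pos b).le
  linarith [div_Phi_right_le hab]

lemma iterLogSum_sub_le {a b : ℝ} (hab : a ≤ b) : iterLogSum b - iterLogSum a ≤ b - a :=
  (le_div_Phi_left hab).trans (div_le_self (sub_nonneg.2 hab) (one_le_Phi a))

lemma sum_Ioc_inv_Phi_le {m n : ℕ} (hmn : m ≤ n) :
    ∑ t ∈ Finset.Ioc m n, 1 / Phi t ≤ iterLogSum n - iterLogSum m := by
  induction n, hmn using Nat.le_induction with
  | base => simp
  | succ n hmn ih =>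
    rw [Finset.sum_Ioc_succ_top (by omega)]
    have h := div_Phi_right_le (a := (n : ℝ)) (b := ((n + 1 : ℕ) : ℝ)) (by simp)
    rw [show ((n + 1 : ℕ) : ℝ) - n = 1 by simp] at h
    linarith

lemma le_sum_Ico_inv_Phi {m n : ℕ} (hmn : m ≤ n) :
    iterLogSum n - iterLogSum m ≤ ∑ t ∈ Finset.Ico m n, 1 / Phi t := by
  induction n, hmn using Nat.le_induction with
  | base => simp
  | succ n hmn ih =>
    rw [Finset.sum_Ico_succ_top hmn]
    have h := le_div_Phi_left (a := (n : ℝ)) (b := ((n + 1 : ℕ) : ℝ)) (by simp)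
    rw [show ((n + 1 : ℕ) : ℝ) - n = 1 by simp] at h
    linarith

lemma sum_Icc_two_pow_mul (m : ℕ) (y : ℝ) :
    ∑ t ∈ Finset.Icc 1 m, 2 ^ t * y = 2 * ((2 ^ m - 1) * y) := by
  induction m with
  | zero => simp
  | succ m ih =>
    rw [Finset.sum_Icc_succ_top (by omega), ih]
    ring

lemma sum_ite_mem_le {s u : Finset ℕ} {f : ℕ → ℝ} (hf : ∀ t ∈ u, 0 ≤ f t) :
    (∑ t ∈ s, if t ∈ u then f t else 0) ≤ ∑ t ∈ u, f t := by
  rw [Finset.sum_ite_mem]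
  exact Finset.sum_le_sum_of_subset_of_nonneg Finset.inter_subset_right fun i hi _ => hf i hi

lemma iterLogSum_mul_sub_le {K X : ℝ} {m N : ℕ} (hK : 1 ≤ K) (hX : 1 ≤ X)
    (hm : X < 2 ^ (m + 1)) (hN : (N : ℝ) ≤ K * X) :
    iterLogSum N - iterLogSum m ≤ 2 + Real.log K := by
  have h1 := iterLogSum_mono hN
  have hlogK := Real.log_nonneg hK
  rw [iterLogSum_of_one_le (t := K * X) (by nlinarith), Real.log_mul (by linarith) (by linarith)] at h1
  have h2 := iterLogSum_sub_le (a := Real.log X) (b := Real.log K + Real.log X) (by linarith)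
  have h3 : Real.log X ≤ m + 1 := by
    have h4 : Real.log X ≤ Real.log (2 ^ (m + 1)) := Real.log_le_log (by linarith) hm.le
    rw [Real.log_pow] at h4
    push_cast at h4
    have h5 : Real.log 2 ≤ 1 := by linarith [Real.log_two_lt_d9]
    nlinarith [(Nat.cast_nonneg m : (0 : ℝ) ≤ m)]
  have h4 := iterLogSum_mono h3
  have h5 := iterLogSum_sub_le (a := (m : ℝ)) (b := m + 1) (by linarith)
  linarith

lemma C1_ne_top_of_le_div_Phi {w : ℕ → ℝ} (hw : ∀ t : ℕ, 1 ≤ t → 0 < w t) {K : ℝ}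
    (hK : 1 ≤ K) (h : ∀ t : ℕ, 2 ≤ t → w t ≤ K / Phi t) : C1 w ≠ ⊤ := by
  refine ne_top_of_le_ne_top
    (ENNReal.ofReal_ne_top (r := w 1 + 2 + K * (2 + Real.log K))) (iSup₂_le fun y hy => ?_)
  set X : ℝ := max 1 (1 / y) with hXdef
  have hX1 : 1 ≤ X := le_max_left _ _
  have hXy : 1 / y ≤ X := le_max_right _ _
  obtain ⟨m, hm1, hm2⟩ := exists_nat_pow_near hX1 one_lt_two
  set N : ℕ := ⌊K * X⌋₊ with hNdef
  have hKX : 1 ≤ K * X := by nlinarith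
  have hN : (N : ℝ) ≤ K * X := Nat.floor_le (by linarith)
  have hN1 : 1 ≤ N := Nat.le_floor (by simpa using hKX)
  have hmN : m ≤ N := by
    refine Nat.le_floor ?_
    have h1 : (m : ℝ) ≤ 2 ^ m := by exact_mod_cast Nat.lt_two_pow_self.le
    nlinarith
  have hmy : (2 ^ m - 1) * y ≤ 1 := by
    rcases le_max_iff.1 hm1 with h1 | h1
    · nlinarith
    · rw [le_div_iff₀ hy] at h1
      linarith
  have hle : ∀ t : ℕ, 2 ≤ t → y < w t → t ≤ N := by
    intro t ht hyt
    refine Nat.le_floor ?_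
    have h1 := hyt.trans_le (h t ht)
    rw [lt_div_iff₀ (Phi_pos _)] at h1
    have h2 : Phi t ≤ K * (1 / y) := by
      rw [mul_one_div, le_div_iff₀ hy]
      linarith
    have h3 : K * (1 / y) ≤ K * X := by gcongr
    linarith [le_Phi t]
  rw [tsum_eq_sum (s := Finset.range (N + 1))]
  swap
  · intro t ht
    rw [Finset.mem_range, not_lt] at ht
    refine if_neg fun hc => ?_
    have := hle t (by omega) hc.2.1
    omega
  have hpt : ∀ t : ℕ, (if 1 ≤ t ∧ y < w t ∧ w t < 2 ^ t * y then ENNReal.ofReal (w t) else 0)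
      ≤ ENNReal.ofReal ((if t ∈ ({1} : Finset ℕ) then w t else 0)
        + (if t ∈ Finset.Icc 1 m then 2 ^ t * y else 0)
        + (if t ∈ Finset.Ioc m N then K * (1 / Phi t) else 0)) := by
    intro t
    have hb : 0 ≤ if t ∈ Finset.Icc 1 m then 2 ^ t * y else 0 := by split_ifs <;> positivity
    have hc : 0 ≤ if t ∈ Finset.Ioc m N then K * (1 / Phi t) else 0 := by
      have := Phi_pos t
      split_ifs <;> positivity
    by_cases hcond : 1 ≤ t ∧ y < w t ∧ w t < 2 ^ t * y
    swap
    · rw [if_neg hcond]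
      exact bot_le
    rw [if_pos hcond]
    refine ENNReal.ofReal_le_ofReal ?_
    by_cases ht1 : t = 1
    · rw [if_pos (by simpa using ht1)]
      linarith
    rw [if_neg (by simpa using ht1), zero_add]
    by_cases htm : t ≤ m
    · rw [if_pos (Finset.mem_Icc.2 ⟨hcond.1, htm⟩)]
      linarith [hcond.2.2]
    · rw [if_pos (Finset.mem_Ioc.2 ⟨by omega, hle t (by omega) hcond.2.1⟩), mul_one_div]
      linarith [h t (by omega)]
  have hnn : ∀ t : ℕ, 0 ≤ (if t ∈ ({1} : Finset ℕ) then w t else 0)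
        + (if t ∈ Finset.Icc 1 m then 2 ^ t * y else 0)
        + (if t ∈ Finset.Ioc m N then K * (1 / Phi t) else 0) := by
    intro t
    have := Phi_pos t
    have ha : 0 ≤ if t ∈ ({1} : Finset ℕ) then w t else 0 := by
      split_ifs with ht
      · exact (hw t (Finset.mem_singleton.1 ht).ge).le
      · exact le_rfl
    refine add_nonneg (add_nonneg ha ?_) ?_ <;> split_ifs <;> positivity
  refine (Finset.sum_le_sum fun t _ => hpt t).trans ?_
  rw [← ENNReal.ofReal_sum_of_nonneg fun t _ => hnn t]
  refine ENNReal.ofReal_le_ofReal ?_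
  rw [Finset.sum_add_distrib, Finset.sum_add_distrib]
  refine add_le_add (add_le_add ?_ ?_) ?_
  · refine (sum_ite_mem_le ?_).trans (by simp)
    intro t ht
    exact (hw t (Finset.mem_singleton.1 ht).ge).le
  · refine (sum_ite_mem_le fun t _ => by positivity).trans ?_
    rw [sum_Icc_two_pow_mul]
    linarith
  · refine (sum_ite_mem_le fun t _ => ?_).trans ?_
    · have := Phi_pos t
      positivity
    rw [← Finset.mul_sum]
    have h1 := (sum_Ioc_inv_Phi_le hmN).trans (iterLogSum_mul_sub_le hK hX1 hm2 hN)
    gcongr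

lemma C1_eq_top_of_unbounded {w : ℕ → ℝ} (h : ∀ B : ℝ, ∃ t : ℕ, 1 ≤ t ∧ B < w t) :
    C1 w = ⊤ := by
  refine ENNReal.eq_top_of_forall_nnreal_le fun r => ?_
  obtain ⟨t, ht, hr⟩ := h r
  have hpos : 0 < w t := r.coe_nonneg.trans_lt hr
  have h2 : (2 : ℝ) ≤ 2 ^ t := by simpa using pow_le_pow_right₀ (one_le_two (α := ℝ)) ht
  refine le_trans ?_ (le_iSup₂ (3 / 4 * w t) (by positivity))
  refine le_trans ?_ (ENNReal.le_tsum t)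
  rw [if_pos ⟨ht, by linarith, by nlinarith⟩, ← ENNReal.ofReal_coe_nnreal]
  exact ENNReal.ofReal_le_ofReal hr.le

lemma half_le_sum_Ico_inv_Phi {k : ℕ} (hk : 8 ≤ Real.log (k * Real.log 2)) (h3 : 3 * k ≤ 2 ^ k) :
    1 / 2 ≤ ∑ t ∈ Finset.Ico (3 * k) (2 ^ k), 1 / Phi t := by
  refine le_trans ?_ (le_sum_Ico_inv_Phi h3)
  have hl1 := Real.log_two_gt_d9
  have hl2 := Real.log_two_lt_d9
  push_cast
  rw [iterLogSum_of_one_le (one_le_pow₀ one_le_two), Real.log_pow]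
  set s : ℝ := k * Real.log 2 with hs
  have hs0 : 0 ≤ s := by positivity
  have hs1 : 1 ≤ s := by
    by_contra! hlt
    linarith [Real.log_nonpos hs0 hlt.le]
  have h4 : 3 * (k : ℝ) ≤ 5 * s := by
    rw [hs]
    nlinarith [(Nat.cast_nonneg k : (0 : ℝ) ≤ k)]
  have h5 := iterLogSum_mono h4
  have h6 := le_div_Phi_left (a := s) (b := 5 * s) (by linarith)
  have h7 : (5 * s - s) / Phi s ≤ 1 / 2 := by
    rw [div_le_iff₀ (Phi_pos s), Phi_of_one_le hs1]
    nlinarith [le_Phi (Real.log s)]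
  linarith

lemma C1_eq_top_of_tendsto_of_le {w : ℕ → ℝ} {B : ℝ} (hB : 0 < B)
    (hwB : ∀ t : ℕ, 1 ≤ t → w t ≤ B)
    (h : Tendsto (fun t : ℕ => w t * Phi t) atTop atTop) : C1 w = ⊤ := by
  refine ENNReal.eq_top_of_forall_nnreal_le fun r => ?_
  set M : ℝ := 2 * r + 1 with hM
  have hM0 : 0 < M := by positivity
  obtain ⟨T, hT⟩ := eventually_atTop.1 (h.eventually_ge_atTop M)
  have e1 : ∀ᶠ k : ℕ in atTop, 8 ≤ Real.log (k * Real.log 2) :=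
    (Real.tendsto_log_atTop.comp (tendsto_natCast_atTop_atTop.atTop_mul_const
      (Real.log_pos one_lt_two))).eventually_ge_atTop 8
  have e2 : ∀ᶠ k : ℕ in atTop, 2 * B / M < (2 : ℝ) ^ k :=
    (tendsto_pow_atTop_atTop_of_one_lt (one_lt_two (α := ℝ))).eventually_gt_atTop _
  obtain ⟨k, hk1, hk2, hk4, hkT⟩ :=
    (e1.and (e2.and ((eventually_ge_atTop 4).and (eventually_ge_atTop T)))).exists
  have hk3 : 3 * k ≤ 2 ^ k := by
    clear hk1 hk2 hkT
    induction k, hk4 using Nat.le_induction with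
    | base => norm_num
    | succ k hk ih =>
      rw [pow_succ]
      omega
  have hsum := half_le_sum_Ico_inv_Phi hk1 hk3
  rw [div_lt_iff₀ hM0] at hk2
  have hp : (0 : ℝ) < 2 ^ k := by positivity
  set y : ℝ := 2 * B / 2 ^ (3 * k) with hy
  have hy0 : 0 < y := by positivity
  have hmain : ∀ t ∈ Finset.Ico (3 * k) (2 ^ k),
      M * (1 / Phi t) ≤ w t ∧ 1 ≤ t ∧ y < w t ∧ w t < 2 ^ t * y := by
    intro t ht
    rw [Finset.mem_Ico] at ht
    have ht1 : 1 ≤ t := by omega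
    have h1 : M * (1 / Phi t) ≤ w t := by
      rw [mul_one_div, div_le_iff₀ (Phi_pos _)]
      exact hT t (by omega)
    refine ⟨h1, ht1, h1.trans_lt' ?_, (hwB t ht1).trans_lt ?_⟩
    · have h2 : Phi t ≤ (2 ^ k) ^ 2 := by
        refine (Phi_le_sq (by exact_mod_cast ht1)).trans ?_
        have : (t : ℝ) ≤ 2 ^ k := by exact_mod_cast ht.2.le
        gcongr
      rw [mul_one_div, hy, lt_div_iff₀ (Phi_pos _), div_mul_eq_mul_div,
        div_lt_iff₀ (by positivity), mul_comm 3 k, pow_mul]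
      calc 2 * B * Phi t ≤ 2 * B * (2 ^ k) ^ 2 := by gcongr
        _ < 2 ^ k * M * (2 ^ k) ^ 2 := by gcongr
        _ = M * (2 ^ k) ^ 3 := by ring
    · rw [hy, mul_div_assoc', lt_div_iff₀ (by positivity)]
      have h2 : (2 : ℝ) ^ (3 * k) ≤ 2 ^ t := pow_le_pow_right₀ one_le_two ht.1
      have h3 : (0 : ℝ) < 2 ^ (3 * k) := by positivity
      nlinarith
  refine le_trans ?_ (le_iSup₂ y hy0)
  refine le_trans ?_ (ENNReal.sum_le_tsum (Finset.Ico (3 * k) (2 ^ k)))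
  calc (r : ℝ≥0∞) = ENNReal.ofReal r := (ENNReal.ofReal_coe_nnreal).symm
    _ ≤ ENNReal.ofReal (∑ t ∈ Finset.Ico (3 * k) (2 ^ k), M * (1 / Phi t)) := by
      refine ENNReal.ofReal_le_ofReal ?_
      rw [← Finset.mul_sum]
      nlinarith
    _ = ∑ t ∈ Finset.Ico (3 * k) (2 ^ k), ENNReal.ofReal (M * (1 / Phi t)) := by
      refine ENNReal.ofReal_sum_of_nonneg fun t _ => ?_
      have := Phi_pos t
      positivity
    _ ≤ _ := by
      refine Finset.sum_le_sum fun t ht => ?_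
      rw [if_pos (hmain t ht).2]
      exact ENNReal.ofReal_le_ofReal (hmain t ht).1

theorem stmt6 (w : ℕ → ℝ) (hw : ∀ t : ℕ, 1 ≤ t → 0 < w t) :
    ((∃ K : ℝ, 0 < K ∧ ∀ t : ℕ, 2 ≤ t → w t ≤ K / Phi t) → C1 w ≠ ⊤) ∧
    (Tendsto (fun t : ℕ => w t * Phi t) atTop atTop → C1 w = ⊤) := by
  constructor
  · rintro ⟨K, -, h⟩
    refine C1_ne_top_of_le_div_Phi hw (le_max_left 1 K) fun t ht => (h t ht).trans ?_
    exact div_le_div_of_nonneg_right (le_max_right 1 K) (Phi_pos t).le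
  · intro h
    by_cases hB : ∃ B : ℝ, ∀ t : ℕ, 1 ≤ t → w t ≤ B
    · obtain ⟨B, hB⟩ := hB
      exact C1_eq_top_of_tendsto_of_le ((hw 1 le_rfl).trans_le (hB 1 le_rfl)) hB h
    · push Not at hB
      exact C1_eq_top_of_unbounded hB
end
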